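/- Define on Y a new norm |y| = max( (1+ε)^{-1}‖y‖, sup_{i≠j}(|f_i(y)| + |f_j(y)|) ), where {x_i; f_i} is a biorthogonal system on Y satisfying ‖x_i‖ ≤ 1 + ε and sup_{i≠j}(|f_i(y)| + |f_j(y)|) ≤ (1+ε)‖y‖ for all y ∈ Y. Then |·| is a norm on Y with (1+ε)^{-1}‖y‖ ≤ |y| ≤ (1+ε)‖y‖, and in this norm |x_i| = 1 for every i and |x_i ± x_j| ≥ 2 for all i ≠ j. -/

import Mathlib

open Filter Topology

/-- The norm `|y| = max((1+ε)⁻¹‖y‖, sup_{i≠j}(|f_i y| + |f_j y|))`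
built from a biorthogonal system with `‖x_i‖ ≤ 1+ε` and
`sup_{i≠j}(|f_i y|+|f_j y|) ≤ (1+ε)‖y‖` is indeed a norm, is `(1+ε)`-equivalent to `‖·‖`,
makes each `x_i` a unit vector, and satisfies `|x_i ± x_j| ≥ 2` for `i ≠ j`. -/
theorem max_norm_biorthogonal_properties
    {Y : Type*} [NormedAddCommGroup Y] [NormedSpace ℝ Y]
    (ε : ℝ) (hε : ε ∈ Set.Ioo (0 : ℝ) 1)
    (x : ℕ → Y) (f : ℕ → Y →L[ℝ] ℝ)
    (hbi : ∀ i j, f i (x j) = if i = j then 1 else 0)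
    (hx : ∀ i, ‖x i‖ ≤ 1 + ε)
    (hf : ∀ i j, i ≠ j → ∀ y : Y, |f i y| + |f j y| ≤ (1 + ε) * ‖y‖)
    (N : Y → ℝ)
    (hN : ∀ y, N y = max ((1 + ε)⁻¹ * ‖y‖)
        (⨆ p : {p : ℕ × ℕ // p.1 ≠ p.2}, (|f p.1.1 y| + |f p.1.2 y|))) :
    (∀ y z, N (y + z) ≤ N y + N z) ∧
    (∀ (c : ℝ) (y : Y), N (c • y) = |c| * N y) ∧
    (∀ y, N y = 0 → y = 0) ∧
    (∀ y, (1 + ε)⁻¹ * ‖y‖ ≤ N y ∧ N y ≤ (1 + ε) * ‖y‖) ∧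
    (∀ i, N (x i) = 1) ∧
    (∀ i j, i ≠ j → 2 ≤ N (x i + x j) ∧ 2 ≤ N (x i - x j)) := by
  have hpos : 0 < 1 + ε := by linarith [hε.1]
  have hinv : (1 + ε)⁻¹ ≤ 1 + ε :=
    (inv_le_one_of_one_le₀ (by linarith [hε.1])).trans (by linarith [hε.1])
  have norm_le : ∀ y, (1 + ε)⁻¹ * ‖y‖ ≤ N y := fun y => hN y ▸ le_max_left _ _
  have pair_le : ∀ i j, i ≠ j → ∀ y, |f i y| + |f j y| ≤ N y := by
    intro i j hij y
    rw [hN y]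
    refine le_max_of_le_right ?_
    refine le_ciSup (f := fun p : {p : ℕ × ℕ // p.1 ≠ p.2} => |f p.1.1 y| + |f p.1.2 y|)
      ⟨(1 + ε) * ‖y‖, ?_⟩ ⟨(i, j), hij⟩
    rintro _ ⟨p, rfl⟩
    exact hf _ _ p.2 y
  have le_of_bounds : ∀ y B, (1 + ε)⁻¹ * ‖y‖ ≤ B →
      (∀ i j, i ≠ j → |f i y| + |f j y| ≤ B) → N y ≤ B := by
    intro y B h₁ h₂
    have : Nonempty {p : ℕ × ℕ // p.1 ≠ p.2} := ⟨⟨(0, 1), by simp⟩⟩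
    rw [hN y]
    exact max_le h₁ (ciSup_le fun p => h₂ _ _ p.2)
  refine ⟨?_, ?_, ?_, ?_, ?_, ?_⟩
  · intro y z
    refine le_of_bounds _ _ ?_ ?_
    · calc (1 + ε)⁻¹ * ‖y + z‖ ≤ (1 + ε)⁻¹ * (‖y‖ + ‖z‖) := by
            gcongr
            exact norm_add_le y z
        _ ≤ N y + N z := by linarith [norm_le y, norm_le z]
    · intro i j hij
      rw [map_add, map_add]
      linarith [abs_add_le (f i y) (f i z), abs_add_le (f j y) (f j z),
        pair_le i j hij y, pair_le i j hij z]
  · intro c y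
    rw [hN, hN, mul_max_of_nonneg _ _ (abs_nonneg c), Real.mul_iSup_of_nonneg (abs_nonneg c)]
    simp only [map_smul, smul_eq_mul, abs_mul, norm_smul, Real.norm_eq_abs, mul_add,
      mul_left_comm]
  · intro y hy
    have h := norm_le y
    rw [hy] at h
    exact norm_le_zero_iff.1 (nonpos_of_mul_nonpos_right h (inv_pos.2 hpos))
  · exact fun y => ⟨norm_le y, le_of_bounds _ _
      (mul_le_mul_of_nonneg_right hinv (norm_nonneg y)) fun i j hij => hf i j hij y⟩
  · intro i
    refine le_antisymm (le_of_bounds _ _ ?_ ?_) ?_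
    · rw [inv_mul_le_iff₀ hpos, mul_one]
      exact hx i
    · intro j k hjk
      rw [hbi, hbi]
      split_ifs with h₁ h₂
      · exact absurd (h₁.trans h₂.symm) hjk
      all_goals norm_num
    · simpa [hbi] using pair_le i (i + 1) (by simp) (x i)
  · intro i j hij
    constructor
    · have h := pair_le i j hij (x i + x j)
      simp only [map_add, hbi, if_neg hij, if_neg hij.symm, if_true] at h
      norm_num at h
      exact h
    · have h := pair_le i j hij (x i - x j)
      simp only [map_sub, hbi, if_neg hij, if_neg hij.symm, if_true] at h
      norm_num at h
      exact h
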